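/- There exist constants c, C > 0 such that for all t ∈ (0,1], c/log(16/t) ≤ η(t) ≤ C/log(16/t). -/

import Mathlib

open Real

/-- The complete elliptic integral of the first kind. -/
noncomputable def ellipticK (k : ℝ) : ℝ :=
  ∫ θ in (0 : ℝ)..(π / 2), 1 / Real.sqrt (1 - k ^ 2 * Real.sin θ ^ 2)

/-- The modulus function `η(t) = K(√(1 - e^{-t})) / K(e^{-t/2})`. -/
noncomputable def boxModulus (t : ℝ) : ℝ :=
  ellipticK (Real.sqrt (1 - Real.exp (-t))) / ellipticK (Real.exp (-t / 2))

lemma continuous_ellipticK_integrand {k : ℝ} (hk : k ^ 2 < 1) :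
    Continuous fun θ : ℝ => 1 / Real.sqrt (1 - k ^ 2 * Real.sin θ ^ 2) := by
  refine continuous_const.div (by fun_prop) fun θ => ?_
  have : 0 < 1 - k ^ 2 * Real.sin θ ^ 2 := by nlinarith [Real.sin_sq_le_one θ, sq_nonneg k]
  exact (Real.sqrt_pos.2 this).ne'

lemma pi_div_two_le_ellipticK {k : ℝ} (hk : k ^ 2 < 1) : π / 2 ≤ ellipticK k := by
  have h : ∫ _ in (0 : ℝ)..(π / 2), (1 : ℝ) ≤ ellipticK k := by
    refine intervalIntegral.integral_mono_on (by positivity) (by simp)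
      ((continuous_ellipticK_integrand hk).intervalIntegrable _ _) fun θ _ => ?_
    have h0 : 0 < 1 - k ^ 2 * Real.sin θ ^ 2 := by nlinarith [Real.sin_sq_le_one θ, sq_nonneg k]
    rw [le_div_iff₀ (Real.sqrt_pos.2 h0), one_mul, Real.sqrt_le_one]
    nlinarith [mul_nonneg (sq_nonneg k) (sq_nonneg (Real.sin θ))]
  simpa using h

lemma ellipticK_le {k : ℝ} (hk : k ^ 2 < 1) :
    ellipticK k ≤ π / 2 * (1 / Real.sqrt (1 - k ^ 2)) := by
  have h : ellipticK k ≤ ∫ _ in (0 : ℝ)..(π / 2), 1 / Real.sqrt (1 - k ^ 2) := by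
    refine intervalIntegral.integral_mono_on (by positivity)
      ((continuous_ellipticK_integrand hk).intervalIntegrable _ _) (by simp) fun θ _ => ?_
    refine one_div_le_one_div_of_le (Real.sqrt_pos.2 (by linarith)) (Real.sqrt_le_sqrt ?_)
    nlinarith [Real.sin_sq_le_one θ, sq_nonneg k]
  simpa using h

lemma ellipticK_eq_integral_cos (k : ℝ) :
    ellipticK k = ∫ φ in (0 : ℝ)..(π / 2), 1 / Real.sqrt (1 - k ^ 2 * Real.cos φ ^ 2) := by
  have h := intervalIntegral.integral_comp_sub_left (a := 0) (b := π / 2)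
    (fun θ : ℝ => 1 / Real.sqrt (1 - k ^ 2 * Real.sin θ ^ 2)) (π / 2)
  simp only [Real.sin_pi_div_two_sub, sub_self, sub_zero] at h
  exact h.symm

lemma continuous_ellipticK_integrand_cos {k : ℝ} (hk : k ^ 2 < 1) :
    Continuous fun φ : ℝ => 1 / Real.sqrt (1 - k ^ 2 * Real.cos φ ^ 2) := by
  have h : Continuous fun φ : ℝ => π / 2 - φ := by fun_prop
  simpa only [Function.comp_def, Real.sin_pi_div_two_sub] using
    (continuous_ellipticK_integrand hk).comp h

lemma integral_one_div_add {s b : ℝ} (hs : 0 < s) (hb : 0 ≤ b) :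
    ∫ φ in (0 : ℝ)..b, 1 / (s + φ) = Real.log (1 + b / s) := by
  rw [intervalIntegral.integral_comp_add_left (fun x : ℝ => 1 / x) s, add_zero,
    integral_one_div_of_pos hs (by linarith)]
  congr 1
  field_simp

lemma intervalIntegrable_one_div_add {s b : ℝ} (hs : 0 < s) (hb : 0 ≤ b) :
    IntervalIntegrable (fun φ : ℝ => 1 / (s + φ)) MeasureTheory.volume 0 b := by
  refine ContinuousOn.intervalIntegrable ?_
  rw [Set.uIcc_of_le hb]
  exact continuousOn_const.div (by fun_prop) fun φ hφ => by linarith [hφ.1]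

lemma log_le_ellipticK {k s : ℝ} (hs : 0 < s) (hks : k ^ 2 = 1 - s ^ 2) :
    Real.log (1 + π / 2 / s) ≤ ellipticK k := by
  have hk : k ^ 2 < 1 := by nlinarith
  rw [ellipticK_eq_integral_cos, ← integral_one_div_add hs (by positivity)]
  refine intervalIntegral.integral_mono_on (by positivity)
    (intervalIntegrable_one_div_add hs (by positivity))
    ((continuous_ellipticK_integrand_cos hk).intervalIntegrable _ _) fun φ hφ => ?_
  have h0 : 0 < 1 - k ^ 2 * Real.cos φ ^ 2 := by nlinarith [Real.cos_sq_le_one φ, sq_nonneg k]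
  refine one_div_le_one_div_of_le (Real.sqrt_pos.2 h0) ?_
  rw [Real.sqrt_le_left (by linarith [hφ.1])]
  have h1 : Real.sin φ ^ 2 ≤ φ ^ 2 := sq_le_sq'
    (by linarith [hφ.1, Real.sin_nonneg_of_nonneg_of_le_pi hφ.1 (by linarith [hφ.2, Real.pi_pos])])
    (Real.sin_le hφ.1)
  have h2 := Real.sin_sq_add_cos_sq φ
  nlinarith [mul_nonneg hs.le hφ.1, mul_nonneg (sq_nonneg s) (sq_nonneg (Real.sin φ))]

lemma ellipticK_le_log {k s : ℝ} (hs : 0 < s) (hks : k ^ 2 = 1 - s ^ 2)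
    (hk' : 0.36 ≤ k ^ 2) : ellipticK k ≤ 4 * Real.log (1 + π / 2 / s) := by
  have hk : k ^ 2 < 1 := by nlinarith
  rw [ellipticK_eq_integral_cos, ← integral_one_div_add hs (by positivity),
    ← intervalIntegral.integral_const_mul]
  refine intervalIntegral.integral_mono_on (by positivity)
    ((continuous_ellipticK_integrand_cos hk).intervalIntegrable _ _)
    ((intervalIntegrable_one_div_add hs (by positivity)).const_mul 4) fun φ hφ => ?_
  have h0 : 0 < 1 - k ^ 2 * Real.cos φ ^ 2 := by nlinarith [Real.cos_sq_le_one φ, sq_nonneg k]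
  have hsφ : 0 < s + φ := by linarith [hφ.1]
  rw [mul_one_div, div_le_div_iff₀ (Real.sqrt_pos.2 h0) hsφ, one_mul, mul_comm,
    ← div_le_iff₀ (by norm_num)]
  refine Real.le_sqrt_of_sq_le ?_
  have h1 : 0.625 * φ ≤ Real.sin φ := by
    refine le_trans (mul_le_mul_of_nonneg_right ?_ hφ.1) (Real.mul_le_sin hφ.1 hφ.2)
    rw [le_div_iff₀ Real.pi_pos]
    linarith [Real.pi_lt_d2]
  have h2 : (0.625 * φ) ^ 2 ≤ Real.sin φ ^ 2 :=
    pow_le_pow_left₀ (by linarith [hφ.1]) h1 2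
  have h3 := Real.sin_sq_add_cos_sq φ
  have h4 : 1 - k ^ 2 * Real.cos φ ^ 2 = s ^ 2 + k ^ 2 * Real.sin φ ^ 2 := by
    linear_combination (-k ^ 2) * h3 - hks
  have h5 : 0.36 * Real.sin φ ^ 2 ≤ k ^ 2 * Real.sin φ ^ 2 :=
    mul_le_mul_of_nonneg_right hk' (sq_nonneg _)
  rw [h4]
  nlinarith [sq_nonneg (s - φ), sq_nonneg s, sq_nonneg φ]

lemma log_sixteen_div_le {s t : ℝ} (ht : 0 < t) (hs : 0 < s) (hst : s ^ 2 ≤ t) :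
    Real.log (16 / t) ≤ 4 * Real.log (1 + π / 2 / s) := by
  have h : (4 : ℝ) * Real.log (1 + π / 2 / s) = Real.log ((1 + π / 2 / s) ^ 4) := by
    rw [Real.log_pow]; norm_num
  rw [h]
  refine Real.log_le_log (by positivity) ?_
  have h1 : 1 / s ≤ π / 2 / s := by
    gcongr; linarith [Real.pi_gt_three]
  have h2 : 16 / t ≤ 16 / s ^ 2 := by gcongr
  have h3 : 16 / s ^ 2 ≤ (1 + 1 / s) ^ 4 := by
    have h5 : 4 * (1 / s) ≤ (1 + 1 / s) ^ 2 := by nlinarith [sq_nonneg (1 - 1 / s)]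
    have h6 : (4 * (1 / s)) ^ 2 ≤ ((1 + 1 / s) ^ 2) ^ 2 := pow_le_pow_left₀ (by positivity) h5 2
    calc 16 / s ^ 2 = (4 * (1 / s)) ^ 2 := by ring
      _ ≤ _ := h6
      _ = _ := by ring
  have h4 : (1 + 1 / s) ^ 4 ≤ (1 + π / 2 / s) ^ 4 := by gcongr
  linarith

lemma two_mul_log_le {s t : ℝ} (ht : 0 < t) (ht1 : t ≤ 1) (hs : 0 < s) (hst : t / 2 ≤ s ^ 2) :
    2 * Real.log (1 + π / 2 / s) ≤ Real.log (16 / t) := by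
  have h : (2 : ℝ) * Real.log (1 + π / 2 / s) = Real.log ((1 + π / 2 / s) ^ 2) := by
    rw [Real.log_pow]; norm_num
  rw [h]
  refine Real.log_le_log (by positivity) ?_
  have hpi := Real.pi_lt_d2
  have hpi0 := Real.pi_pos
  set u := Real.sqrt t with hu
  have hu0 : 0 < u := Real.sqrt_pos.2 ht
  have hu2 : u ^ 2 = t := Real.sq_sqrt ht.le
  have hu1 : u ≤ 1 := by nlinarith
  have hus : u * (2 / 3) ≤ s := by
    refine pow_le_pow_iff_left₀ (by positivity) hs.le two_ne_zero |>.1 ?_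
    nlinarith
  have h1 : 1 + π / 2 / s ≤ 4 / u := by
    have h2 : π / 2 / s ≤ 1.575 / (u * (2 / 3)) := by gcongr; linarith
    have h3 : 1.575 / (u * (2 / 3)) ≤ 3 / u := by
      rw [div_le_div_iff₀ (by positivity) hu0]; linarith
    have h4 : 1 ≤ 1 / u := by rw [le_div_iff₀ hu0]; linarith
    have h5 : 4 / u = 1 / u + 3 / u := by ring
    linarith
  calc (1 + π / 2 / s) ^ 2 ≤ (4 / u) ^ 2 := by gcongr
    _ = 16 / t := by rw [div_pow, hu2]; norm_num

/-- There exist constants `c, C > 0` such that for all `t ∈ (0, 1]`,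
`c / log (16 / t) ≤ η t ≤ C / log (16 / t)`. -/
theorem boxModulus_small_regime :
    ∃ c C : ℝ, 0 < c ∧ 0 < C ∧
      ∀ t ∈ Set.Ioc (0 : ℝ) 1,
        c / Real.log (16 / t) ≤ boxModulus t ∧
        boxModulus t ≤ C / Real.log (16 / t) := by
  refine ⟨π / 4, 4 * π, by positivity, by positivity, fun t ht => ?_⟩
  obtain ⟨ht0, ht1⟩ := ht
  have hm_le : 1 - Real.exp (-t) ≤ t := by linarith [Real.add_one_le_exp (-t)]
  have hexp : Real.exp (-t) ≤ 1 - t / 2 := by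
    rw [Real.exp_neg]
    refine inv_le_of_inv_le₀ (by linarith) ?_
    refine le_trans ?_ (Real.add_one_le_exp t)
    rw [inv_le_iff_one_le_mul₀ (by linarith)]
    nlinarith
  have hexp' : 0.36 ≤ Real.exp (-t) := by
    have h := Real.exp_le_exp.2 (neg_le_neg ht1)
    linarith [Real.exp_neg_one_gt_d9]
  set s := Real.sqrt (1 - Real.exp (-t)) with hs_def
  have hs2 : s ^ 2 = 1 - Real.exp (-t) := Real.sq_sqrt (by linarith)
  have hs : 0 < s := Real.sqrt_pos.2 (by linarith)
  have hk2 : Real.exp (-t / 2) ^ 2 = Real.exp (-t) := by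
    rw [← Real.exp_nat_mul]; congr 1; push_cast; ring
  have hks : Real.exp (-t / 2) ^ 2 = 1 - s ^ 2 := by rw [hk2, hs2]; ring
  have hs1 : s ^ 2 < 1 := by linarith
  have hN1 := pi_div_two_le_ellipticK hs1
  have hN2 : ellipticK s ≤ π := by
    refine (ellipticK_le hs1).trans ?_
    have h : 1 / 2 ≤ Real.sqrt (1 - s ^ 2) := Real.le_sqrt_of_sq_le (by linarith)
    have h' : 1 / Real.sqrt (1 - s ^ 2) ≤ 2 := by
      rw [div_le_iff₀ (by linarith)]; linarith
    nlinarith [Real.pi_pos]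
  have hD1 := log_le_ellipticK hs hks
  have hD2 := ellipticK_le_log hs hks (by rw [hk2]; exact hexp')
  have hL1 := log_sixteen_div_le ht0 hs (by linarith)
  have hL2 := two_mul_log_le ht0 ht1 hs (by linarith)
  have hL : 0 < Real.log (16 / t) := Real.log_pos (by rw [lt_div_iff₀ ht0]; linarith)
  have hD : 0 < ellipticK (Real.exp (-t / 2)) := by linarith
  have hpi := Real.pi_pos
  unfold boxModulus
  rw [← hs_def]
  constructor
  · rw [div_le_div_iff₀ hL hD]
    nlinarith
  · rw [div_le_div_iff₀ hD hL]
    nlinarith
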